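/- arXiv:0710.0834 — 3 statements merged into one kernel-verified Lean document; each statement's English description precedes it below -/
import Mathlib

section
/- If two n-linear forms (n ≥ 2) on finite-dimensional complex vector spaces are symmetrically equivalent, then they are congruent. -/
section Defs

variable {K : Type*} [Field K] {n : ℕ}

/-- The restriction of a multilinear form to a submodule. -/
def formRestrict {U : Type*} [AddCommGroup U] [Module K U]
    (F : MultilinearMap K (fun _ : Fin n => U) K) (W : Submodule K U) :
    MultilinearMap K (fun _ : Fin n => W) K :=
  F.compLinearMap fun _ => W.subtype

/-- Two multilinear forms are congruent if a single linear bijection carries one to the other. -/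
def FormCongruent {U V : Type*} [AddCommGroup U] [Module K U] [AddCommGroup V] [Module K V]
    (F : MultilinearMap K (fun _ : Fin n => U) K)
    (G : MultilinearMap K (fun _ : Fin n => V) K) : Prop :=
  ∃ φ : U ≃ₗ[K] V, ∀ u : Fin n → U, F u = G fun i => φ (u i)

/-- Symmetric equivalence of multilinear forms. -/
def FormSymmEquiv {U V : Type*} [AddCommGroup U] [Module K U] [AddCommGroup V] [Module K V]
    (F : MultilinearMap K (fun _ : Fin n => U) K)
    (G : MultilinearMap K (fun _ : Fin n => V) K) : Prop :=
  ∃ φ : Fin n → U ≃ₗ[K] V, ∀ (σ : Equiv.Perm (Fin n)) (u : Fin n → U),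
    F u = G fun i => φ (σ i) (u i)

/-- `W` is a direct-sum decomposition of the underlying space for which `F` vanishes on
mixed tuples, i.e. `F = ⨁ᵢ F|Wᵢ`. -/
def IsDecompFamily {U : Type*} [AddCommGroup U] [Module K U] {ι : Type*} [DecidableEq ι]
    (F : MultilinearMap K (fun _ : Fin n => U) K) (W : ι → Submodule K U) : Prop :=
  DirectSum.IsInternal W ∧
    ∀ (x : Fin n → U) (k l : Fin n) (i j : ι), i ≠ j → x k ∈ W i → x l ∈ W j → F x = 0

/-- A multilinear form is indecomposable if in every direct-sum decomposition one of the
two subspaces is zero. -/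
def FormIndecomposable {U : Type*} [AddCommGroup U] [Module K U]
    (F : MultilinearMap K (fun _ : Fin n => U) K) : Prop :=
  ∀ W₁ W₂ : Submodule K U, IsCompl W₁ W₂ →
    (∀ (x : Fin n → U) (k l : Fin n), x k ∈ W₁ → x l ∈ W₂ → F x = 0) →
    W₁ = ⊥ ∨ W₂ = ⊥

/-- A multilinear form has no zero direct summands if in every direct-sum decomposition the
summand that is the zero form corresponds to the zero subspace. -/
def FormNoZeroSummand {U : Type*} [AddCommGroup U] [Module K U]
    (F : MultilinearMap K (fun _ : Fin n => U) K) : Prop :=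
  ∀ W₁ W₂ : Submodule K U, IsCompl W₁ W₂ →
    (∀ (x : Fin n → U) (k l : Fin n), x k ∈ W₁ → x l ∈ W₂ → F x = 0) →
    (∀ x : Fin n → U, (∀ k, x k ∈ W₂) → F x = 0) → W₂ = ⊥

/-- A linear map `τ` is `G`-selfadjoint if applying `τ` in any one argument of `G`
gives the same value regardless of the argument chosen. -/
def FormSelfAdjoint {V : Type*} [AddCommGroup V] [Module K V]
    (G : MultilinearMap K (fun _ : Fin n => V) K) (τ : V →ₗ[K] V) : Prop :=
  ∀ (v : Fin n → V) (i j : Fin n),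
    G (Function.update v i (τ (v i))) = G (Function.update v j (τ (v j)))

end Defs

namespace FormSelfAdjoint

open Function Polynomial

section Field

variable {K V : Type*} [Field K] [AddCommGroup V] [Module K V] {n : ℕ}
  {G : MultilinearMap K (fun _ : Fin n => V) K}

theorem id : FormSelfAdjoint G (1 : Module.End K V) := by
  intro v i j
  simp

theorem add {S T : Module.End K V} (hS : FormSelfAdjoint G S) (hT : FormSelfAdjoint G T) :
    FormSelfAdjoint G (S + T) := by
  intro v i j
  simp only [LinearMap.add_apply, MultilinearMap.map_update_add, hS v i j, hT v i j]

theorem smul {S : Module.End K V} (c : K) (hS : FormSelfAdjoint G S) :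
    FormSelfAdjoint G (c • S) := by
  intro v i j
  simp only [LinearMap.smul_apply, MultilinearMap.map_update_smul, hS v i j]

theorem mul_of_commute {S T : Module.End K V} (hS : FormSelfAdjoint G S)
    (hT : FormSelfAdjoint G T) (h : Commute S T) : FormSelfAdjoint G (S * T) := by
  intro v i j
  rcases eq_or_ne i j with rfl | hij
  · rfl
  have h₁ := hS (update v i (T (v i))) i j
  have h₂ := hT (update v j (S (v j))) i j
  simp only [update_self, update_idem, update_of_ne hij, update_of_ne hij.symm] at h₁ h₂
  rw [update_comm hij.symm] at h₂
  calc G (update v i ((S * T) (v i))) = _ := h₁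
    _ = _ := h₂
    _ = G (update v j ((S * T) (v j))) := by rw [h.eq]; rfl

theorem pow {S : Module.End K V} (hS : FormSelfAdjoint G S) (k : ℕ) :
    FormSelfAdjoint G (S ^ k) := by
  induction k with
  | zero => simpa using id
  | succ k ih => exact pow_succ S k ▸ ih.mul_of_commute hS ((Commute.refl S).pow_left k)

theorem aeval {S : Module.End K V} (hS : FormSelfAdjoint G S) (p : K[X]) :
    FormSelfAdjoint G (Polynomial.aeval S p) := by
  induction p using Polynomial.induction_on' with
  | add p q hp hq => simpa using hp.add hq
  | monomial k c =>
    rw [aeval_monomial, ← Algebra.smul_def]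
    exact (hS.pow k).smul c

/-- Selfadjoint maps applied in distinct arguments can be collected in a single argument `j`, in
an order prescribed by the labels `σ i` of the arguments rather than by their positions. -/
theorem map_ite_mem {A : Fin n → Module.End K V} (hA : ∀ i, FormSelfAdjoint G (A i))
    (σ : Equiv.Perm (Fin n)) (j : Fin n) (l : List (Fin n)) (hl : l.Nodup) (hj : σ j ∉ l)
    (w : Fin n → V) :
    G (fun i => if σ i ∈ l then A (σ i) (w i) else w i) =
      G (update w j ((l.map A).prod (w j))) := by
  induction l generalizing w with
  | nil => simp
  | cons a l ih =>
    obtain ⟨hal, hnd⟩ := List.nodup_cons.1 hl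
    obtain ⟨hja, hjl⟩ : σ j ≠ a ∧ σ j ∉ l := by simpa using hj
    obtain ⟨k, rfl⟩ := σ.surjective a
    have hjk : j ≠ k := fun h => hja (h ▸ rfl)
    have h₁ := ih hnd hjl (update w k (A (σ k) (w k)))
    have h₂ := hA (σ k) (update w j ((l.map A).prod (w j))) k j
    simp only [update_self, update_idem, update_of_ne hjk, update_of_ne hjk.symm] at h₁ h₂
    rw [update_comm hjk.symm, h₂] at h₁
    rw [List.map_cons, List.prod_cons, Module.End.mul_apply, ← h₁]
    congr 1
    ext i
    rcases eq_or_ne i k with rfl | hik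
    · simp [hal]
    · simp [hik]

theorem map_pow {R : Module.End K V} (hR : FormSelfAdjoint G R) (j : Fin n) (w : Fin n → V) :
    G (fun i => R (w i)) = G (update w j ((R ^ n) (w j))) := by
  have h := map_ite_mem (A := fun _ => R) (fun _ => hR) 1 j (Finset.univ.erase j).toList
    (Finset.nodup_toList _) (by simp) (update w j (R (w j)))
  have hn : n - 1 + 1 = n := Nat.sub_add_cancel j.pos
  simp only [List.map_const', List.prod_replicate, Finset.length_toList, update_self,
    update_idem, Finset.card_erase_of_mem (Finset.mem_univ j), Finset.card_univ,
    Fintype.card_fin, ← Module.End.mul_apply, ← pow_succ, hn] at h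
  rw [← h]
  congr 1
  ext i
  rcases eq_or_ne i j with rfl | hij
  · simp
  · simp [hij]

end Field

end FormSelfAdjoint

section Root

open Polynomial

theorem exists_pow_eq_of_isNilpotent_pow_sub {A : Type*} [CommRing A] {n : ℕ}
    (hn : IsUnit (n : A)) {s x : A} (hs : IsUnit s) (hx : IsNilpotent (x ^ n - s)) :
    ∃ r : A, r ^ n = s := by
  rcases Nat.eq_zero_or_pos n with rfl | hpos
  · have : Subsingleton A :=
      subsingleton_of_zero_eq_one (isUnit_zero_iff.1 (by rwa [Nat.cast_zero] at hn))
    exact ⟨0, Subsingleton.elim _ _⟩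
  have hxn : IsUnit (x ^ n) := by
    simpa using hx.isUnit_add_left_of_commute hs (Commute.all _ _)
  have hxu : IsUnit x := (isUnit_pow_iff hpos.ne').1 hxn
  obtain ⟨r, ⟨-, hr⟩, -⟩ := Polynomial.existsUnique_nilpotent_sub_and_aeval_eq_zero
    (P := (X ^ n - C s : A[X])) (x := x) (by simpa using hx)
    (by simpa [derivative_X_pow] using And.intro hn (hxu.pow (n - 1)))
  exact ⟨r, by simpa [sub_eq_zero] using hr⟩

theorem Polynomial.dvd_pow_natDegree_of_forall_isRoot {K : Type*} [Field K] [IsAlgClosed K]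
    {f q : K[X]} (hf : f ≠ 0) (h : ∀ a, f.IsRoot a → q.IsRoot a) : f ∣ q ^ f.natDegree := by
  have hs := IsAlgClosed.splits f
  have hd : (f.roots.map fun a => X - C a).prod ∣ (f.roots.map fun _ => q).prod :=
    Multiset.prod_dvd_prod_of_dvd _ _ fun a ha =>
      dvd_iff_isRoot.2 (h a (isRoot_of_mem_roots ha))
  rw [Multiset.map_const', Multiset.prod_replicate] at hd
  rw [← hs.natDegree_eq_card_roots] at hd
  refine (Eq.dvd hs.eq_prod_roots).trans ?_
  rwa [(isUnit_C.2 (leadingCoeff_ne_zero.2 hf).isUnit).mul_left_dvd]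

theorem Polynomial.exists_dvd_pow_sub_X {f : ℂ[X]} (hf : f.coeff 0 ≠ 0) {n : ℕ} (hn : n ≠ 0) :
    ∃ p : ℂ[X], f ∣ p ^ n - X := by
  have hf₀ : f ≠ 0 := by rintro rfl; simp at hf
  choose c hc using fun z : ℂ => IsAlgClosed.exists_pow_nat_eq z (Nat.pos_of_ne_zero hn)
  let q := Lagrange.interpolate f.roots.toFinset _root_.id c
  have hq : f ∣ (q ^ n - X) ^ f.natDegree := by
    refine dvd_pow_natDegree_of_forall_isRoot hf₀ fun a ha => ?_
    have : q.eval a = c a := Lagrange.eval_interpolate_at_node (v := _root_.id) c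
      (Set.injOn_id _) (by simpa [hf₀] using ha)
    simp [this, hc]
  have hX : IsUnit (AdjoinRoot.root f) := by
    have : IsCoprime X f := (Polynomial.irreducible_X.coprime_iff_not_dvd).2
      (by rwa [X_dvd_iff])
    obtain ⟨a, b, hab⟩ := this
    refine IsUnit.of_mul_eq_one (AdjoinRoot.mk f a) ?_
    have := congrArg (AdjoinRoot.mk f) hab
    simpa [mul_comm] using this
  have hnu : IsUnit (n : AdjoinRoot f) := by
    have := (IsUnit.mk0 (n : ℂ) (by exact_mod_cast hn)).map (algebraMap ℂ (AdjoinRoot f))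
    simpa using this
  obtain ⟨r, hr⟩ := exists_pow_eq_of_isNilpotent_pow_sub hnu hX
    (x := AdjoinRoot.mk f q) ⟨f.natDegree, by
      rw [← AdjoinRoot.mk_X, ← _root_.map_pow, ← map_sub, ← _root_.map_pow]
      exact AdjoinRoot.mk_eq_zero.2 hq⟩
  obtain ⟨p, rfl⟩ := AdjoinRoot.mk_surjective r
  refine ⟨p, AdjoinRoot.mk_eq_zero.1 ?_⟩
  simp [hr]

theorem Module.End.exists_aeval_pow_eq {V : Type*} [AddCommGroup V] [Module ℂ V]
    [FiniteDimensional ℂ V] {S : Module.End ℂ V} (hS : Function.Injective S) {n : ℕ}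
    (hn : n ≠ 0) : ∃ p : ℂ[X], aeval S p ^ n = S := by
  obtain ⟨p, hp⟩ := Polynomial.exists_dvd_pow_sub_X
    (LinearMap.minpoly_coeff_zero_of_injective hS) hn
  exact ⟨p, by simpa [sub_eq_zero] using (minpoly.dvd_iff (A := ℂ) (x := S)).1 hp⟩

end Root

section SymmEquiv

open Function

variable {K U V : Type*} [Field K] [AddCommGroup U] [Module K U] [AddCommGroup V] [Module K V]
  {n : ℕ} {F : MultilinearMap K (fun _ : Fin n => U) K}
  {G : MultilinearMap K (fun _ : Fin n => V) K}

theorem formSelfAdjoint_comp_symm {φ : Fin n → U ≃ₗ[K] V}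
    (h : ∀ (σ : Equiv.Perm (Fin n)) (u : Fin n → U), F u = G fun i => φ (σ i) (u i))
    (k z : Fin n) : FormSelfAdjoint G ((φ k : U →ₗ[K] V) ∘ₗ ((φ z).symm : V →ₗ[K] U)) := by
  intro v i j
  rcases eq_or_ne i j with rfl | hij
  · rfl
  rcases eq_or_ne k z with rfl | hkz
  · simp
  obtain ⟨σ, hi, hj⟩ : ∃ σ : Equiv.Perm (Fin n), σ i = k ∧ σ j = z := by
    have hne : Equiv.swap i k j ≠ k := by
      rw [Ne, Equiv.swap_apply_eq_iff, Equiv.swap_apply_right]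
      exact hij.symm
    refine ⟨(Equiv.swap i k).trans (Equiv.swap (Equiv.swap i k j) z), ?_, ?_⟩
    · simp [Equiv.swap_apply_of_ne_of_ne hne.symm hkz]
    · simp
  let u : Fin n → U := fun m =>
    if m = i ∨ m = j then (φ z).symm (v m) else (φ (σ m)).symm (v m)
  have h₁ := h σ u
  rw [h ((Equiv.swap i j).trans σ) u] at h₁
  convert h₁.symm using 2
  · ext m
    rcases eq_or_ne m i with rfl | hmi
    · simp [u, hi]
    rcases eq_or_ne m j with rfl | hmj
    · simp [u, hj, hmi]
    · simp [u, hmi, hmj]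
  · ext m
    rcases eq_or_ne m j with rfl | hmj
    · simp [u, hi]
    rcases eq_or_ne m i with rfl | hmi
    · simp [u, hj, hmj]
    · simp [u, hmi, hmj, Equiv.swap_apply_of_ne_of_ne hmi hmj]

theorem FormSymmEquiv.exists_update (h : FormSymmEquiv F G) (z : Fin n) :
    ∃ (φ : U ≃ₗ[K] V) (S : Module.End K V), Injective S ∧
      ∀ (u : Fin n → U) (j : Fin n),
        F u = G (update (fun i => φ (u i)) j (S (φ (u j)))) := by
  obtain ⟨φ, h⟩ := h
  let A : Fin n → Module.End K V := fun k =>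
    (φ k : U →ₗ[K] V) ∘ₗ ((φ z).symm : V →ₗ[K] U)
  refine ⟨φ z, ((Finset.univ.erase z).toList.map A).prod, ?_, fun u j => ?_⟩
  · have hA : ∀ l : List (Fin n), Injective (l.map A).prod := by
      intro l
      induction l with
      | nil => exact injective_id
      | cons a l ih =>
        rw [List.map_cons, List.prod_cons, Module.End.coe_mul]
        exact ((φ a).injective.comp (φ z).symm.injective).comp ih
    exact hA _
  · have := FormSelfAdjoint.map_ite_mem (A := A) (fun k => formSelfAdjoint_comp_symm h k z)
      (Equiv.swap j z) j (Finset.univ.erase z).toList (Finset.nodup_toList _) (by simp)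
      (fun i => φ z (u i))
    rw [← this, h (Equiv.swap j z) u]
    congr 1
    ext i
    by_cases hi : Equiv.swap j z i = z
    · simp [hi]
    · simp [hi, A]

end SymmEquiv

/-- If two `n`-linear forms (`n ≥ 2`) on finite-dimensional complex vector spaces are
symmetrically equivalent, then they are congruent. -/
theorem stmt_0 {n : ℕ} (hn : 2 ≤ n) {U V : Type*}
    [AddCommGroup U] [Module ℂ U] [FiniteDimensional ℂ U]
    [AddCommGroup V] [Module ℂ V] [FiniteDimensional ℂ V]
    (F : MultilinearMap ℂ (fun _ : Fin n => U) ℂ)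
    (G : MultilinearMap ℂ (fun _ : Fin n => V) ℂ)
    (h : FormSymmEquiv F G) :
    FormCongruent F G := by
  have z : Fin n := ⟨0, by omega⟩
  obtain ⟨φ, S, hS, hF⟩ := h.exists_update z
  have hSA : FormSelfAdjoint G S := fun v i j => by
    have := (hF (fun m => φ.symm (v m)) i).symm.trans (hF (fun m => φ.symm (v m)) j)
    simpa using this
  obtain ⟨p, hp⟩ := Module.End.exists_aeval_pow_eq hS (show n ≠ 0 by omega)
  have hR : Function.Injective (Polynomial.aeval S p) := by
    rw [← hp] at hS
    exact Module.End.injective_of_iterate_injective (by omega) hS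
  refine ⟨φ.trans (LinearEquiv.ofInjectiveEndo _ hR), fun u => ?_⟩
  have := (hSA.aeval p).map_pow z fun i => φ (u i)
  rw [hp, ← hF] at this
  exact this.symm
end

section
/- Let T be a nonsingular complex square matrix having a single eigenvalue (i.e., the spectrum of T is a singleton). Then for every positive integer m there exists a polynomial f(x) ∈ ℂ[x] such that f(T)^m = T⁻¹. -/
open Polynomial in
/-- A complex square matrix with a single eigenvalue is that scalar plus a nilpotent matrix. -/
theorem Matrix.isNilpotent_sub_algebraMap_of_spectrum_eq_singleton {n : Type*} [Fintype n]
    [DecidableEq n] (T : Matrix n n ℂ) (lam : ℂ) (h : spectrum ℂ T = {lam}) :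
    IsNilpotent (T - algebraMap ℂ _ lam) := by
  have hroots : T.charpoly.roots = Multiset.replicate T.charpoly.roots.card lam := by
    refine Multiset.eq_replicate_card.2 fun x hx => ?_
    have : x ∈ spectrum ℂ T := Matrix.mem_spectrum_iff_isRoot_charpoly.2 (isRoot_of_mem_roots hx)
    simpa [h] using this
  have hprod := (IsAlgClosed.splits T.charpoly).eq_prod_roots_of_monic T.charpoly_monic
  rw [hroots, Multiset.map_replicate, Multiset.prod_replicate] at hprod
  refine ⟨T.charpoly.roots.card, ?_⟩
  have hCH := T.aeval_self_charpoly
  rw [hprod] at hCH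
  simpa using hCH

open Polynomial in
/-- In a commutative `ℂ`-algebra, the inverse of a nonzero scalar plus a nilpotent has roots of
every positive order. -/
theorem exists_mul_pow_eq_one_of_isNilpotent_sub {S : Type*} [CommRing S] [Algebra ℂ S] (t : S)
    {lam : ℂ} (hlam : lam ≠ 0) (h : IsNilpotent (t - algebraMap ℂ S lam)) {m : ℕ} (hm : 0 < m) :
    ∃ s : S, t * s ^ m = 1 := by
  obtain ⟨c, hc⟩ := IsAlgClosed.exists_pow_nat_eq lam⁻¹ hm
  have hc0 : c ≠ 0 := by
    rintro rfl
    rw [zero_pow hm.ne'] at hc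
    exact inv_ne_zero hlam hc.symm
  have ht : IsUnit t := by
    have := h.isUnit_add_left_of_commute ((IsUnit.mk0 lam hlam).map (algebraMap ℂ S))
      (Commute.all _ _)
    simpa using this
  have hP : IsNilpotent (aeval (algebraMap ℂ S c) (C t * X ^ m - 1 : S[X])) := by
    have : aeval (algebraMap ℂ S c) (C t * X ^ m - 1 : S[X]) =
        (t - algebraMap ℂ S lam) * algebraMap ℂ S lam⁻¹ := by
      rw [sub_mul, ← map_mul, mul_inv_cancel₀ hlam]
      simp [← hc]
    rw [this]
    exact (Commute.all _ _).isNilpotent_mul_right h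
  have hP' : IsUnit (aeval (algebraMap ℂ S c) (derivative (C t * X ^ m - 1 : S[X]))) := by
    have hmc : IsUnit (algebraMap ℂ S (m * c ^ (m - 1))) :=
      (IsUnit.mk0 _ (mul_ne_zero (by exact_mod_cast hm.ne') (pow_ne_zero _ hc0))).map _
    simpa [derivative_X_pow] using ht.mul hmc
  obtain ⟨s, ⟨-, hs⟩, -⟩ := existsUnique_nilpotent_sub_and_aeval_eq_zero hP hP'
  exact ⟨s, by simpa [sub_eq_zero] using hs⟩

/-- Let `T` be a nonsingular complex square matrix having a single eigenvalue (the spectrum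
of `T` is a singleton). Then for every positive integer `m` there is a polynomial
`f ∈ ℂ[x]` with `f(T)^m = T⁻¹`. -/
theorem stmt_3 {k : ℕ} (T : Matrix (Fin k) (Fin k) ℂ) (hT : IsUnit T.det)
    (hspec : ∃ lam : ℂ, spectrum ℂ T = {lam}) :
    ∀ m : ℕ, 0 < m → ∃ f : Polynomial ℂ, (Polynomial.aeval T f) ^ m = T⁻¹ := by
  intro m hm
  obtain ⟨lam, hlam⟩ := hspec
  have hlam0 : lam ≠ 0 := by
    rintro rfl
    exact spectrum.zero_mem_iff ℂ |>.1 (hlam ▸ Set.mem_singleton (0 : ℂ))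
      ((Matrix.isUnit_iff_isUnit_det T).2 hT)
  let t : (Polynomial.aeval (R := ℂ) T).range := ⟨T, Polynomial.X, by simp⟩
  have ht : IsNilpotent (t - algebraMap ℂ _ lam) := by
    obtain ⟨n, hn⟩ := T.isNilpotent_sub_algebraMap_of_spectrum_eq_singleton lam hlam
    exact ⟨n, Subtype.ext hn⟩
  let _ : CommRing (Polynomial.aeval (R := ℂ) T).range :=
    { (inferInstance : Ring (Polynomial.aeval (R := ℂ) T).range) with
      mul_comm := by
        rintro ⟨_, p, rfl⟩ ⟨_, q, rfl⟩
        exact Subtype.ext (by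
          change Polynomial.aeval T p * Polynomial.aeval T q =
            Polynomial.aeval T q * Polynomial.aeval T p
          rw [← map_mul, mul_comm, map_mul]) }
  obtain ⟨⟨_, f, rfl⟩, hs⟩ := exists_mul_pow_eq_one_of_isNilpotent_sub t hlam0 ht hm
  exact ⟨f, (Matrix.inv_eq_right_inv (congrArg Subtype.val hs)).symm⟩
end

section
/- Let T be a real square matrix whose set of complex eigenvalues consists either of one positive real number, or of a pair of distinct conjugate complex numbers a + ib and a − ib with b ≠ 0. Then for every positive integer m there exists a polynomial f(x) ∈ ℝ[x] such that f(T)^m = T⁻¹. -/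
open Polynomial in
/-- Newton iteration: an approximate `m`-th root of the inverse of `X`, correct modulo a divisor of
a power of the error, lifts to an exact one. -/
theorem Polynomial.exists_dvd_X_mul_pow_sub_one {K : Type*} [Field K] [CharZero K] {p g : K[X]}
    {m n : ℕ} (hm : 0 < m) (h : p ∣ (X * g ^ m - 1) ^ n) : ∃ f : K[X], p ∣ X * f ^ m - 1 := by
  let t : AdjoinRoot p := AdjoinRoot.mk p X
  let x : AdjoinRoot p := AdjoinRoot.mk p g
  have hnil : IsNilpotent (t * x ^ m - 1) := by
    refine ⟨n, ?_⟩
    have := AdjoinRoot.mk_eq_zero.2 h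
    simpa [t, x] using this
  have hunit : IsUnit (t * x ^ m) := by
    simpa using hnil.isUnit_add_one
  have hx : IsUnit x := (isUnit_pow_iff hm.ne').1 (isUnit_of_mul_isUnit_right hunit)
  have hmu : IsUnit (m : AdjoinRoot p) := by
    have : IsUnit (m : K) := (Nat.cast_ne_zero.2 hm.ne').isUnit
    simpa using this.map (algebraMap K (AdjoinRoot p))
  obtain ⟨r, ⟨-, hr⟩, -⟩ := Polynomial.existsUnique_nilpotent_sub_and_aeval_eq_zero
    (P := (C t * X ^ m - 1 : (AdjoinRoot p)[X])) (x := x) (by simpa using hnil)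
    (by simpa [derivative_X_pow] using
      (isUnit_of_mul_isUnit_left hunit).mul (hmu.mul (hx.pow (m - 1))))
  obtain ⟨f, rfl⟩ := AdjoinRoot.mk_surjective r
  exact ⟨f, AdjoinRoot.mk_eq_zero.1 (by simpa [t] using hr)⟩

open Polynomial in
/-- A real polynomial vanishing on the complex spectrum of a real matrix has a power divisible by
the characteristic polynomial. -/
theorem Matrix.charpoly_dvd_pow_of_forall_spectrum {k : ℕ} (T : Matrix (Fin k) (Fin k) ℝ)
    (g : ℝ[X]) (h : ∀ z ∈ spectrum ℂ (T.map (algebraMap ℝ ℂ)), aeval z g = 0) :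
    ∃ n : ℕ, T.charpoly ∣ g ^ n := by
  refine ⟨T.charpoly.natDegree, ?_⟩
  rw [← Polynomial.map_dvd_map' (algebraMap ℝ ℂ), Polynomial.map_pow]
  have hmonic := T.charpoly_monic.map (algebraMap ℝ ℂ)
  have hs := IsAlgClosed.splits (T.charpoly.map (algebraMap ℝ ℂ))
  have hdvd : ∀ s : Multiset ℂ, (∀ z ∈ s, aeval z g = 0) →
      (s.map fun z => X - C z).prod ∣ g.map (algebraMap ℝ ℂ) ^ s.card := by
    intro s
    induction s using Multiset.induction with
    | empty => simp
    | cons a s ih =>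
      intro hz
      rw [Multiset.map_cons, Multiset.prod_cons, Multiset.card_cons, pow_succ']
      refine mul_dvd_mul ?_ (ih fun z hzs => hz z (Multiset.mem_cons_of_mem hzs))
      rw [dvd_iff_isRoot, IsRoot, eval_map_algebraMap]
      exact hz a (Multiset.mem_cons_self a s)
  have hcard := hs.natDegree_eq_card_roots
  rw [hs.eq_prod_roots_of_monic hmonic]
  rw [natDegree_map] at hcard
  rw [hcard]
  refine hdvd _ fun z hz => h z ?_
  rw [Matrix.mem_spectrum_iff_isRoot_charpoly, Matrix.charpoly_map]
  exact isRoot_of_mem_roots hz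

open Polynomial in
theorem stmt_4 {k : ℕ} (T : Matrix (Fin k) (Fin k) ℝ)
    (hspec :
      (∃ lam : ℝ, 0 < lam ∧
        spectrum ℂ (T.map (algebraMap ℝ ℂ)) = {(lam : ℂ)}) ∨
      (∃ a b : ℝ, b ≠ 0 ∧
        spectrum ℂ (T.map (algebraMap ℝ ℂ)) =
          {(a : ℂ) + (b : ℂ) * Complex.I, (a : ℂ) - (b : ℂ) * Complex.I})) :
    ∀ m : ℕ, 0 < m → ∃ f : Polynomial ℝ, (Polynomial.aeval T f) ^ m = T⁻¹ := by
  intro m hm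
  obtain ⟨g, hg⟩ : ∃ g : ℝ[X], ∀ z ∈ spectrum ℂ (T.map (algebraMap ℝ ℂ)),
      aeval z (X * g ^ m - 1) = 0 := by
    rcases hspec with ⟨lam, hlam, hs⟩ | ⟨a, b, hb, hs⟩
    · refine ⟨C (lam⁻¹ ^ (m : ℝ)⁻¹), ?_⟩
      rw [hs]
      rintro z rfl
      have h := Real.rpow_inv_natCast_pow (inv_nonneg.2 hlam.le) hm.ne'
      rw [← C_pow, h]
      simp [hlam.ne']
    · have hz : (a : ℂ) + b * Complex.I ≠ 0 := by
        intro h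
        exact hb (by simpa using congrArg Complex.im h)
      obtain ⟨w, hw⟩ := IsAlgClosed.exists_pow_nat_eq ((a : ℂ) + b * Complex.I)⁻¹ hm
      have hroot : aeval ((a : ℂ) + b * Complex.I)
          (X * (C w.re + C (w.im / b) * (X - C a)) ^ m - 1 : ℝ[X]) = 0 := by
        have hb' : (b : ℂ) ≠ 0 := by exact_mod_cast hb
        have : (w.re : ℂ) + w.im / b * (b * Complex.I) = w := by
          rw [← mul_assoc, div_mul_cancel₀ _ hb', Complex.re_add_im]
        simp [this, hw, hz]
      refine ⟨C w.re + C (w.im / b) * (X - C a), ?_⟩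
      rw [hs]
      rintro z (rfl | rfl)
      · exact hroot
      · have hconj : (a : ℂ) - b * Complex.I = (starRingEnd ℂ) (a + b * Complex.I) := by
          simp [sub_eq_add_neg]
        rw [hconj, aeval_conj, hroot, map_zero]
  obtain ⟨n, hn⟩ := T.charpoly_dvd_pow_of_forall_spectrum _ hg
  obtain ⟨f, q, hf⟩ := exists_dvd_X_mul_pow_sub_one hm hn
  refine ⟨f, (Matrix.inv_eq_right_inv ?_).symm⟩
  have := congrArg (aeval T) hf
  simpa [Matrix.aeval_self_charpoly, sub_eq_zero] using this
end
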